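/- Let a, b > 0, let K = B₂ⁿ / vol_n(B₂ⁿ)^{1/n} and L = (1/2) B_∞ⁿ, and let M_n = co[(K, −a), (L, b)] ⊆ ℝ^{n+1}. Then the (n+1)-st coordinate of the centroid of M_n satisfies lim_{n→∞} ⟨g(M_n), e_{n+1}⟩ = (1/e)(−a) + (1 − 1/e) b, and all other coordinates of g(M_n) are 0. -/

import Mathlib

open MeasureTheory Filter
open scoped Pointwise RealInnerProductSpace

/-- The centroid (center of gravity) of a set `K`: `(1/vol K) ∫_K x dx`. -/
noncomputable def centroid {E : Type*} [NormedAddCommGroup E] [NormedSpace ℝ E]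
    [MeasureSpace E] (K : Set E) : E :=
  ((volume K).toReal)⁻¹ • ∫ x in K, x

/-- `K = B₂ⁿ / vol_n(B₂ⁿ)^{1/n}`, the Euclidean ball normalized to volume `1`. -/
noncomputable def normBall (n : ℕ) : Set (EuclideanSpace ℝ (Fin n)) :=
  ((volume (Metric.closedBall (0 : EuclideanSpace ℝ (Fin n)) 1)).toReal ^ (1 / (n : ℝ)))⁻¹ •
    Metric.closedBall (0 : EuclideanSpace ℝ (Fin n)) 1

/-- `L = (1/2) B_∞ⁿ`, the cube of volume `1`. -/
noncomputable def normCube (n : ℕ) : Set (EuclideanSpace ℝ (Fin n)) :=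
  (1 / 2 : ℝ) • {x : EuclideanSpace ℝ (Fin n) | ∀ i, |x i| ≤ 1}

/-- `M_n = co[(K, -a), (L, b)] ⊆ ℝ^{n+1}`. -/
noncomputable def Mbody (a b : ℝ) (n : ℕ) : Set (EuclideanSpace ℝ (Fin n) × ℝ) :=
  convexHull ℝ ((normBall n ×ˢ ({-a} : Set ℝ)) ∪ (normCube n ×ˢ ({b} : Set ℝ)))

lemma Gamma_half_sq_le {s : ℝ} (hs : 0 < s) :
    Real.Gamma (s + 1/2) ^ 2 ≤ s * Real.Gamma s ^ 2 := by
  have h := Real.Gamma_mul_add_mul_le_rpow_Gamma_mul_rpow_Gamma (s := s) (t := s + 1)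
    (a := 1/2) (b := 1/2) hs (by linarith) (by norm_num) (by norm_num) (by norm_num)
  have e : (1/2 : ℝ) * s + 1/2 * (s+1) = s + 1/2 := by ring
  rw [e, Real.Gamma_add_one hs.ne', ← Real.sqrt_eq_rpow, ← Real.sqrt_eq_rpow] at h
  have h0 : 0 < Real.Gamma s := Real.Gamma_pos_of_pos hs
  have h1 : 0 < Real.Gamma (s + 1/2) := Real.Gamma_pos_of_pos (by linarith)
  calc Real.Gamma (s + 1/2) ^ 2 ≤ (√(Real.Gamma s) * √(s * Real.Gamma s)) ^ 2 := by gcongr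
    _ = s * Real.Gamma s ^ 2 := by
      rw [mul_pow, Real.sq_sqrt h0.le, Real.sq_sqrt (by positivity)]; ring

lemma Gamma_root_tendsto :
    Tendsto (fun n : ℕ => (Real.Gamma (n/2+1) ^ (1/(n:ℝ)))^2 * (2 / n)) atTop
      (nhds (1 / Real.exp 1)) := by
  -- logarithm
  have hl : Tendsto (fun n : ℕ => Real.log (n:ℝ) / n) atTop (nhds 0) := by
    have := Real.isLittleO_log_id_atTop.tendsto_div_nhds_zero
    exact this.comp tendsto_natCast_atTop_atTop
  have hc : ∀ c : ℝ, Tendsto (fun n : ℕ => c / n) atTop (nhds 0) := fun c =>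
    tendsto_const_div_atTop_nhds_zero_nat c
  have hst : Tendsto (fun n : ℕ => Real.log (Stirling.stirlingSeq n) / n) atTop (nhds 0) := by
    have h1 : Tendsto (fun n : ℕ => Real.log (Stirling.stirlingSeq n)) atTop
      (nhds (Real.log (√Real.pi))) :=
      (Stirling.tendsto_stirlingSeq_sqrt_pi).log (by positivity)
    exact h1.div_atTop tendsto_natCast_atTop_atTop
  set d : ℕ → ℝ := fun n => Real.log (Real.Gamma (n/2+1)) - Real.log (Real.Gamma (n/2+1/2)) with hd
  have hdl : ∀ n : ℕ, 2 ≤ n → 0 ≤ d n := by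
    intro n hn
    have hn' : (2:ℝ) ≤ n := by exact_mod_cast hn
    have h := Gamma_half_sq_le (s := (n:ℝ)/2) (by positivity)
    have hg := Real.Gamma_add_one (s := (n:ℝ)/2) (by positivity)
    have p0 : 0 < Real.Gamma ((n:ℝ)/2) := Real.Gamma_pos_of_pos (by positivity)
    have p1 : 0 < Real.Gamma ((n:ℝ)/2 + 1/2) := Real.Gamma_pos_of_pos (by positivity)
    rw [hd]; simp only [sub_nonneg]
    apply Real.log_le_log p1
    rw [hg]
    apply le_of_sq_le_sq _ (by positivity)
    refine h.trans ?_
    rw [mul_pow]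
    gcongr
    nlinarith
  have hdu : ∀ n : ℕ, 2 ≤ n → d n ≤ Real.log n := by
    intro n hn
    have hn' : (2:ℝ) ≤ n := by exact_mod_cast hn
    have h := Gamma_half_sq_le (s := (n:ℝ)/2+1/2) (by positivity)
    have p0 : 0 < Real.Gamma ((n:ℝ)/2+1) := Real.Gamma_pos_of_pos (by positivity)
    have p1 : 0 < Real.Gamma ((n:ℝ)/2 + 1/2) := Real.Gamma_pos_of_pos (by positivity)
    rw [hd]; simp only
    rw [sub_le_iff_le_add, ← Real.log_mul (by positivity) p1.ne']
    apply Real.log_le_log p0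
    apply le_of_sq_le_sq _ (by positivity)
    have e : (n:ℝ)/2+1/2+1/2 = n/2+1 := by ring
    rw [e] at h
    refine h.trans ?_
    rw [mul_pow]
    gcongr
    nlinarith
  have hdt : Tendsto (fun n : ℕ => d n / n) atTop (nhds 0) := by
    refine tendsto_of_tendsto_of_tendsto_of_le_of_le' tendsto_const_nhds hl ?_ ?_
    · filter_upwards [eventually_ge_atTop 2] with n hn
      exact div_nonneg (hdl n hn) (by positivity)
    · filter_upwards [eventually_ge_atTop 2] with n hn
      have := hdu n hn
      gcongr
  have hE : Tendsto (fun n : ℕ => -1 + ((1/2) * (Real.log 2 / n + Real.log n / n)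
      + Real.log (Stirling.stirlingSeq n) / n + Real.log (√Real.pi) / n + d n / n)) atTop
      (nhds (-1)) := by
    have := ((((((hc (Real.log 2)).add hl).const_mul (1/2)).add hst).add
      (hc (Real.log (√Real.pi)))).add hdt).const_add (-1)
    simpa using this
  have hexp := (Real.continuous_exp.tendsto _).comp hE
  rw [Real.exp_neg, ← one_div] at hexp
  refine hexp.congr' ?_
  filter_upwards [eventually_ge_atTop 2] with n hn
  have hn' : (2:ℝ) ≤ n := by exact_mod_cast hn
  have hn0 : (0:ℝ) < n := by linarith
  have p0 : 0 < Real.Gamma ((n:ℝ)/2+1) := Real.Gamma_pos_of_pos (by positivity)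
  have p1 : 0 < Real.Gamma ((n:ℝ)/2 + 1/2) := Real.Gamma_pos_of_pos (by positivity)
  have hdup := Real.Gamma_mul_Gamma_add_half ((n:ℝ)/2+1/2)
  have e1 : (n:ℝ)/2+1/2+1/2 = n/2+1 := by ring
  have e2 : 2 * ((n:ℝ)/2+1/2) = n + 1 := by ring
  rw [e1, e2, Real.Gamma_nat_eq_factorial] at hdup
  have hlog := congrArg Real.log hdup
  have hf : (0:ℝ) < n.factorial := by positivity
  rw [Real.log_mul p1.ne' p0.ne', Real.log_mul (by positivity) (by positivity),
    Real.log_mul (by positivity) (by positivity), Real.log_rpow (by norm_num)] at hlog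
  have hS := Stirling.log_stirlingSeq_formula n
  rw [Real.log_mul (by norm_num) hn0.ne', Real.log_div hn0.ne' (by positivity), Real.log_exp] at hS
  simp only [Function.comp]
  rw [← Real.exp_log (show 0 < (Real.Gamma ((n:ℝ)/2+1) ^ (1/(n:ℝ)))^2 * (2 / n) by positivity)]
  congr 1
  rw [Real.log_mul (by positivity) (by positivity), Real.log_pow, Real.log_rpow p0,
    Real.log_div (by norm_num) hn0.ne']
  have : Real.log (n.factorial) = Real.log (Stirling.stirlingSeq n) + 1/2 * (Real.log 2 + Real.log n)
     + n * (Real.log n - 1) := by linarith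
  rw [this] at hlog
  have h2 : 2 * Real.log (Real.Gamma ((n:ℝ)/2+1)) = d n + (Real.log (Stirling.stirlingSeq n) + 1/2 * (Real.log 2 + Real.log n)
     + n * (Real.log n - 1) + (1 - (n+1)) * Real.log 2 + Real.log (√Real.pi)) := by
    rw [← hlog]; simp only [hd]; ring
  clear_value d
  generalize Real.log (Real.Gamma ((n:ℝ)/2+1)) = G at h2 ⊢
  push_cast
  have h3 : 2 * (1 / (n:ℝ) * G) = (2 * G) / n := by ring
  rw [h3, h2]
  field_simp
  ring
/-- the weights -/
noncomputable def wt (n m : ℕ) : ℝ :=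
  (Real.Gamma (n/2+1) ^ (1/(n:ℝ))) ^ m / Real.Gamma (m/2+1)

lemma wt_pos (n m : ℕ) : 0 < wt n m := by
  have h1 : 0 < Real.Gamma ((n:ℝ)/2+1) := Real.Gamma_pos_of_pos (by positivity)
  have h2 : 0 < Real.Gamma ((m:ℝ)/2+1) := Real.Gamma_pos_of_pos (by positivity)
  unfold wt; positivity

lemma wt_succ_succ (n m : ℕ) : ((m + 2 : ℕ) : ℝ) * wt n (m+2) =
    2 * (Real.Gamma (n/2+1) ^ (1/(n:ℝ))) ^ 2 * wt n m := by
  have h2 : 0 < Real.Gamma ((m:ℝ)/2+1) := Real.Gamma_pos_of_pos (by positivity)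
  have e : ((m + 2 : ℕ) : ℝ)/2 + 1 = ((m:ℝ)/2+1) + 1 := by push_cast; ring
  unfold wt
  have e2 := Real.Gamma_add_one (s := (m:ℝ)/2+1) (by positivity)
  rw [e, e2]
  generalize Real.Gamma (n/2+1) ^ (1/(n:ℝ)) = x
  clear e2 e
  generalize Real.Gamma ((m:ℝ)/2+1) = G at *
  push_cast
  field_simp
  ring

lemma wt_self (n : ℕ) (hn : n ≠ 0) : wt n n = 1 := by
  have h1 : 0 < Real.Gamma ((n:ℝ)/2+1) := Real.Gamma_pos_of_pos (by positivity)
  unfold wt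
  rw [one_div, Real.rpow_inv_natCast_pow h1.le hn, div_self h1.ne']

lemma wt_pred (n : ℕ) : wt (n+1) n ^ 2 ≤
    ((n:ℝ) + 2) / (2 * (Real.Gamma ((n+1 : ℕ)/2+1) ^ (1/((n+1:ℕ):ℝ))) ^ 2) := by
  have h1 : 0 < Real.Gamma (((n+1:ℕ):ℝ)/2+1) := Real.Gamma_pos_of_pos (by positivity)
  have h2 : 0 < Real.Gamma ((n:ℝ)/2+1) := Real.Gamma_pos_of_pos (by positivity)
  have hs := wt_self (n+1) (by omega)
  have h := Gamma_half_sq_le (s := (n:ℝ)/2+1) (by positivity)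
  have e : (n:ℝ)/2+1+1/2 = ((n+1:ℕ):ℝ)/2+1 := by push_cast; ring
  rw [e] at h
  unfold wt at hs ⊢
  set x := Real.Gamma ((n+1 : ℕ)/2+1) ^ (1/((n+1:ℕ):ℝ))
  have hx : 0 < x := by positivity
  rw [div_eq_one_iff_eq h1.ne'] at hs
  rw [← hs] at h
  rw [div_pow, div_le_div_iff₀ (by positivity) (by positivity)]
  calc (x^n)^2 * (2 * x^2) = 2 * (x^(n+1))^2 := by ring
    _ ≤ 2 * (((n:ℝ)/2+1) * Real.Gamma (n/2+1)^2) := by gcongr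
    _ = _ := by ring

lemma ratio_tendsto : Tendsto (fun n : ℕ => (∑ m ∈ Finset.range (n+1), ((m:ℝ)+1) * wt n m) /
    (((n:ℝ)+2) * ∑ m ∈ Finset.range (n+1), wt n m)) atTop (nhds (1 / Real.exp 1)) := by
  set q : ℕ → ℝ := fun n => (Real.Gamma (n/2+1) ^ (1/(n:ℝ)))^2 with hq
  set S : ℕ → ℝ := fun n => ∑ m ∈ Finset.range (n+1), wt n m with hS
  have hqp : ∀ n, 0 < q n := by
    intro n
    have h1 : 0 < Real.Gamma ((n:ℝ)/2+1) := Real.Gamma_pos_of_pos (by positivity)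
    simp only [hq]; positivity
  have hSp : ∀ n, 0 < S n := fun n => Finset.sum_pos (fun m _ => wt_pos n m) (by simp)
  have hqt : Tendsto (fun n : ℕ => q n * (2 / n)) atTop (nhds (1 / Real.exp 1)) :=
    Gamma_root_tendsto
  have hqi : Tendsto q atTop atTop := by
    have h1 : Tendsto (fun n : ℕ => (n:ℝ) / 2) atTop atTop :=
      tendsto_natCast_atTop_atTop.atTop_div_const (by norm_num)
    refine (hqt.pos_mul_atTop (by positivity) h1).congr' ?_
    filter_upwards [eventually_gt_atTop 0] with n hn
    have : (0:ℝ) < n := by exact_mod_cast hn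
    field_simp
  have hqi0 : Tendsto (fun n => (q n)⁻¹) atTop (nhds 0) := tendsto_inv_atTop_zero.comp hqi
  have hin : Tendsto (fun n : ℕ => 1 / (n:ℝ)) atTop (nhds 0) := tendsto_const_div_atTop_nhds_zero_nat 1
  -- identity
  have hid : ∀ n : ℕ, 2 ≤ n → ∑ m ∈ Finset.range (n+1), ((m:ℝ)+1) * wt n m =
      wt n 1 + 2 * q n * (S n - (wt n (n-1) + wt n n)) + S n := by
    intro n hn
    obtain ⟨N, rfl⟩ := Nat.exists_eq_add_of_le' hn
    have a1 : ∑ m ∈ Finset.range (N+2+1), (m:ℝ) * wt (N+2) m = wt (N+2) 1 +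
        ∑ m ∈ Finset.range (N+1), 2 * q (N+2) * wt (N+2) m := by
      rw [show N + 2 + 1 = (N+1) + 1 + 1 by ring, Finset.sum_range_succ', Finset.sum_range_succ']
      have : ∀ m : ℕ, ((m+1+1 : ℕ):ℝ) * wt (N+1+1) (m+1+1) = 2 * q (N+2) * wt (N+2) m :=
        fun m => wt_succ_succ (N+2) m
      simp only [this]
      simp
      ring
    have a2 : S (N+2) = ∑ m ∈ Finset.range (N+1), wt (N+2) m + wt (N+2) (N+1) + wt (N+2) (N+2) := by
      simp only [hS]
      rw [Finset.sum_range_succ, Finset.sum_range_succ]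
    have a3 : S (N+2) - (wt (N+2) (N+2-1) + wt (N+2) (N+2)) = ∑ m ∈ Finset.range (N+1), wt (N+2) m := by
      rw [a2, show N + 2 - 1 = N + 1 by omega]; ring
    rw [a3, Finset.mul_sum, ← a1, ← Finset.sum_add_distrib]
    exact Finset.sum_congr rfl (fun m _ => by ring)
  -- the boundary term
  have hbd : Tendsto (fun n : ℕ => (wt n (n-1) + wt n n) / S n) atTop (nhds 0) := by
    have hu : Tendsto (fun n : ℕ => (2 + ((q n * (2/n))⁻¹ * (1 + 1/n))) * (q n)⁻¹) atTop (nhds 0) := by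
      have := ((((hqt.inv₀ (by positivity)).mul (hin.const_add 1))).const_add 2).mul hqi0
      simpa using this
    refine tendsto_of_tendsto_of_tendsto_of_le_of_le' tendsto_const_nhds hu ?_ ?_
    · exact Eventually.of_forall fun n => div_nonneg (add_pos (wt_pos _ _) (wt_pos _ _)).le (hSp n).le
    · filter_upwards [eventually_ge_atTop 2] with n hn
      have hn0 : (0:ℝ) < n := by exact_mod_cast (by omega : 0 < n)
      have h2 : q n ≤ S n := by
        have : wt n 2 ≤ S n := Finset.single_le_sum (f := fun m => wt n m)
          (fun m _ => (wt_pos n m).le) (Finset.mem_range.2 (by omega))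
        have e := wt_succ_succ n 0
        have e0 : wt n 0 = 1 := by simp [wt]
        rw [e0] at e
        have e' : (2:ℝ) * wt n 2 = 2 * q n * 1 := by exact_mod_cast e
        linarith
      have h3 : wt n (n-1) ≤ 1 + ((q n * (2/n))⁻¹ * (1 + 1/n)) := by
        obtain ⟨N, rfl⟩ := Nat.exists_eq_add_of_le' (show 1 ≤ n by omega)
        have h := wt_pred N
        have e : ((N:ℝ) + 2) / (2 * q (N+1)) = ((q (N+1) * (2/((N+1 : ℕ):ℝ)))⁻¹ * (1 + 1/((N+1:ℕ):ℝ))) := by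
          have := hqp (N+1)
          push_cast
          field_simp
          ring
        rw [← e]
        have h' : wt (N+1) N ^ 2 ≤ ((N:ℝ) + 2) / (2 * q (N+1)) := h
        simp only [Nat.add_sub_cancel]
        nlinarith [sq_nonneg (wt (N+1) N - 1), sq_nonneg (wt (N+1) N)]
      rw [wt_self n (by omega), div_eq_mul_inv]
      have := hqp n
      have h4 := hSp n
      have h5 : (S n)⁻¹ ≤ (q n)⁻¹ := inv_anti₀ this h2
      exact mul_le_mul (by linarith) h5 (by positivity) (by positivity)
  have hw1 : Tendsto (fun n : ℕ => (wt n 1 / S n) * (1/n)) atTop (nhds 0) := by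
    refine tendsto_of_tendsto_of_tendsto_of_le_of_le' tendsto_const_nhds hin ?_ ?_
    · exact Eventually.of_forall fun n => mul_nonneg (div_nonneg (wt_pos _ _).le (hSp n).le) (by positivity)
    · filter_upwards [eventually_ge_atTop 2] with n hn
      have : wt n 1 ≤ S n := Finset.single_le_sum (f := fun m => wt n m)
          (fun m _ => (wt_pos n m).le) (Finset.mem_range.2 (by omega))
      have h : wt n 1 / S n ≤ 1 := (div_le_one (hSp n)).2 this
      have : (0:ℝ) ≤ 1 / n := by positivity
      nlinarith
  have hn2 : Tendsto (fun n : ℕ => (1 + 2 * (1 / (n:ℝ)))⁻¹) atTop (nhds 1) := by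
    have := ((hin.const_mul 2).const_add 1).inv₀ (by norm_num)
    simpa using this
  have hfin := (((hqt.mul (hbd.const_sub 1)).add hw1).add hin).mul hn2
  simp only [sub_zero, mul_one, add_zero] at hfin
  refine hfin.congr' ?_
  filter_upwards [eventually_ge_atTop 2] with n hn
  have hn0 : (0:ℝ) < n := by exact_mod_cast (by omega : 0 < n)
  rw [hid n hn]
  have := hSp n
  change _ = _ / (((n:ℝ)+2) * S n)
  field_simp
  ring

lemma beta_nat (m k : ℕ) : ∫ t in (0:ℝ)..1, (1-t)^m * t^k =
    (m.factorial * k.factorial : ℝ) / (m+k+1).factorial := by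
  induction m generalizing k with
  | zero => 
    simp [Nat.factorial_succ]
    field_simp
  | succ m ih =>
    have hu : ∀ x ∈ Set.uIcc (0:ℝ) 1, HasDerivAt (fun t : ℝ => (1-t)^(m+1)) (-((m+1:ℝ) * (1-x)^m)) x := by
      intro x _
      have := ((hasDerivAt_id x).const_sub 1).pow (m+1)
      refine this.congr_deriv ?_
      simp
    have hv : ∀ x ∈ Set.uIcc (0:ℝ) 1, HasDerivAt (fun t : ℝ => t^(k+1) / (k+1)) (x^k) x := by
      intro x _
      have := ((hasDerivAt_id x).pow (k+1)).div_const ((k:ℝ)+1)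
      refine this.congr_deriv ?_
      simp
      field_simp
    rw [intervalIntegral.integral_mul_deriv_eq_deriv_mul hu hv
      (Continuous.intervalIntegrable (by fun_prop) _ _) (Continuous.intervalIntegrable (by fun_prop) _ _)]
    have e : ∀ x : ℝ, -((m+1:ℝ) * (1-x)^m) * (x^(k+1)/(k+1)) = (-((m+1:ℝ)/(k+1))) * ((1-x)^m * x^(k+1)) := by
      intro x; ring
    simp only [e]
    rw [intervalIntegral.integral_const_mul, ih (k+1)]
    rw [show m + (k+1) + 1 = m + 1 + k + 1 by ring]
    simp [Nat.factorial_succ]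
    field_simp

/-- excess of `|x|` over `t/2` -/
noncomputable def exc (t x : ℝ) : ℝ := max (|x| - t/2) 0

lemma exc_cont (t : ℝ) : Continuous (exc t) := by unfold exc; fun_prop

/-- volume of the sum of a cube and a ball -/
noncomputable def Fv (n : ℕ) (t q : ℝ) : ENNReal :=
  volume {x : Fin n → ℝ | ∑ i, exc t (x i) ^ 2 ≤ q}

lemma Fv_mono (n : ℕ) (t : ℝ) : Monotone (Fv n t) := by
  intro p q h
  exact measure_mono (fun x hx => le_trans hx h)

lemma Fv_succ (n : ℕ) (t q : ℝ) : Fv (n+1) t q = ∫⁻ y : ℝ, Fv n t (q - exc t y ^ 2) := by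
  have hmp := volume_preserving_piFinSuccAbove (fun _ : Fin (n+1) => ℝ) 0
  have hc := exc_cont t
  have hm : MeasurableSet {p : ℝ × (Fin n → ℝ) | exc t p.1 ^ 2 + ∑ i, exc t (p.2 i) ^ 2 ≤ q} := by
    apply IsClosed.measurableSet
    apply isClosed_le _ continuous_const
    fun_prop
  have hs : {x : Fin (n+1) → ℝ | ∑ i, exc t (x i) ^ 2 ≤ q} =
     (MeasurableEquiv.piFinSuccAbove (fun _ : Fin (n+1) => ℝ) 0) ⁻¹'
      {p : ℝ × (Fin n → ℝ) | exc t p.1 ^ 2 + ∑ i, exc t (p.2 i) ^ 2 ≤ q} := by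
    ext x
    simp [Fin.sum_univ_succ, MeasurableEquiv.piFinSuccAbove, Fin.insertNthEquiv]
    rfl
  unfold Fv
  rw [hs, hmp.measure_preimage hm.nullMeasurableSet, Measure.volume_eq_prod, Measure.prod_apply hm]
  congr 1
  ext y
  congr 1
  ext x
  simp [le_sub_iff_add_le, add_comm]

lemma lint_exc (t : ℝ) (ht : 0 ≤ t) (φ : ℝ → ENNReal) :
    ∫⁻ y, φ (exc t y) = ENNReal.ofReal t * φ 0 + ∫⁻ y, φ |y| := by
  have split : ∀ (f : ℝ → ENNReal) (s : ℝ), 0 ≤ s → ∫⁻ y, f y =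
      (∫⁻ y in Set.Iio (-s), f y) + (∫⁻ y in Set.Icc (-s) s, f y) + ∫⁻ y in Set.Ioi s, f y := by
    intro f s hs
    rw [← lintegral_add_compl f (measurableSet_Iic (a := s)), Set.compl_Iic]
    congr 1
    have : Set.Iic s = Set.Iio (-s) ∪ Set.Icc (-s) s := by
      rw [Set.Iio_union_Icc_eq_Iic (by linarith)]
    rw [this, lintegral_union measurableSet_Icc]
    rw [Set.disjoint_left]
    intro x hx hx'
    exact absurd hx (not_lt.2 hx'.1)
  have h1 : ∫⁻ y in Set.Ioi (t/2), φ (exc t y) = ∫⁻ y in Set.Ioi 0, φ |y| := by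
    rw [← lintegral_indicator measurableSet_Ioi, ← lintegral_indicator measurableSet_Ioi]
    symm
    rw [← lintegral_sub_right_eq_self _ (t/2)]
    symm
    congr 1
    ext y
    by_cases hy : t/2 < y
    · rw [Set.indicator_of_mem (by simpa using hy), Set.indicator_of_mem (by simpa using hy)]
      congr 1
      rw [exc, abs_of_pos (by linarith), abs_of_pos (by linarith), max_eq_left (by linarith)]
    · rw [Set.indicator_of_notMem (by simpa using hy), Set.indicator_of_notMem (by simpa using hy)]
  have h2 : ∫⁻ y in Set.Iio (-(t/2)), φ (exc t y) = ∫⁻ y in Set.Iio (-0), φ |y| := by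
    rw [← lintegral_indicator measurableSet_Iio, ← lintegral_indicator measurableSet_Iio]
    symm
    rw [← lintegral_add_right_eq_self _ (t/2)]
    symm
    congr 1
    ext y
    by_cases hy : y < -(t/2)
    · rw [Set.indicator_of_mem (by simpa using hy), Set.indicator_of_mem (by simp; linarith)]
      congr 1
      rw [exc, abs_of_neg (by linarith), abs_of_neg (by linarith), max_eq_left (by linarith)]
      ring
    · rw [Set.indicator_of_notMem (by simpa using hy), Set.indicator_of_notMem (by simp; linarith)]
  have h3 : ∫⁻ y in Set.Icc (-(t/2)) (t/2), φ (exc t y) = ENNReal.ofReal t * φ 0 := by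
    have : ∫⁻ y in Set.Icc (-(t/2)) (t/2), φ (exc t y) = ∫⁻ y in Set.Icc (-(t/2)) (t/2), φ 0 := by
      apply setLIntegral_congr_fun measurableSet_Icc
      intro y hy
      have : |y| ≤ t/2 := abs_le.2 hy
      simp only [exc]
      rw [max_eq_right (by linarith)]
    rw [this, lintegral_const]
    simp
    rw [mul_comm]
  have h4 : ∫⁻ y in Set.Icc (-(0:ℝ)) 0, φ |y| = 0 := by simp
  rw [split (fun y => φ (exc t y)) (t/2) (by linarith), split (fun y => φ |y|) 0 le_rfl,
    h1, h2, h3, h4]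
  ring

lemma exc_zero (y : ℝ) : exc 0 y = |y| := by simp [exc]

lemma Fv_steiner (n : ℕ) (t : ℝ) (ht : 0 ≤ t) (q : ℝ) : Fv n t q =
    ∑ ij ∈ Finset.HasAntidiagonal.antidiagonal n, n.choose ij.1 • (Fv ij.1 0 q * ENNReal.ofReal t ^ ij.2) := by
  induction n generalizing q with
  | zero => simp [Fv]
  | succ n ih =>
    rw [Finset.sum_antidiagonal_choose_succ_nsmul
      (fun i j => Fv i 0 q * ENNReal.ofReal t ^ j) n, Fv_succ,
      lint_exc t ht (fun s => Fv n t (q - s^2))]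
    symm
    rw [add_comm]
    symm
    rw [add_comm]
    congr 1
    · simp only [Fv_succ, exc_zero]
      simp only [ih]
      rw [lintegral_finsetSum']
      · refine Finset.sum_congr rfl fun ij hij => ?_
        have hm : Measurable (fun y : ℝ => Fv ij.1 0 (q - |y|^2)) :=
          (Fv_mono _ _).measurable.comp (by fun_prop)
        simp only [nsmul_eq_mul]
        rw [lintegral_const_mul _ (by fun_prop), lintegral_mul_const _ hm]
        rw [show n.choose ij.1 = n.choose ij.2 from Nat.choose_symm_of_eq_add (Finset.HasAntidiagonal.mem_antidiagonal.1 hij).symm]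
      · intro ij _
        have hm : Measurable (fun y : ℝ => Fv ij.1 0 (q - |y|^2)) :=
          (Fv_mono _ _).measurable.comp (by fun_prop)
        simp only [nsmul_eq_mul]
        exact (hm.aemeasurable.mul_const _).const_mul _
    · simp only [ne_eq, OfNat.ofNat_ne_zero, not_false_eq_true, zero_pow, sub_zero]
      rw [ih, Finset.mul_sum]
      refine Finset.sum_congr rfl fun ij hij => ?_
      simp only [nsmul_eq_mul]
      ring

/-- volume of unit ball -/
noncomputable def kap (m : ℕ) : ℝ := √Real.pi ^ m / Real.Gamma (m/2+1)

lemma vol_ball (m : ℕ) (r : ℝ) (hr : 0 ≤ r) :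
    volume (Metric.closedBall (0 : EuclideanSpace ℝ (Fin m)) r) = ENNReal.ofReal (r^m * kap m) := by
  rcases m with _ | m
  · have : Metric.closedBall (0 : EuclideanSpace ℝ (Fin 0)) r = {0} := by
      ext x; simp [Subsingleton.elim x 0, hr]
    rw [this, volume_euclideanSpace_eq_dirac]; simp [kap]
  · rw [EuclideanSpace.volume_closedBall, ENNReal.ofReal_mul (by positivity), ENNReal.ofReal_pow hr]
    simp [kap]

lemma vol_eq_Fv (n : ℕ) (t q : ℝ) :
    volume {x : EuclideanSpace ℝ (Fin n) | ∑ i, exc t (x i) ^ 2 ≤ q} = Fv n t q := by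
  have hc := exc_cont t
  have hm : MeasurableSet {x : Fin n → ℝ | ∑ i, exc t (x i) ^ 2 ≤ q} := by
    apply IsClosed.measurableSet
    apply isClosed_le _ continuous_const
    fun_prop
  exact (PiLp.volume_preserving_ofLp (Fin n)).measure_preimage hm.nullMeasurableSet

lemma Fv_ball (m : ℕ) (r : ℝ) (hr : 0 ≤ r) : Fv m 0 (r^2) = ENNReal.ofReal (r^m * kap m) := by
  rw [← vol_ball m r hr, ← vol_eq_Fv]
  congr 1
  ext x
  simp only [exc_zero, Set.mem_ofPred_eq, mem_closedBall_zero_iff, EuclideanSpace.norm_eq,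
    Real.norm_eq_abs]
  rw [Real.sqrt_le_left hr]

lemma kap_pos (m : ℕ) : 0 < kap m := by
  have h1 : 0 < Real.Gamma ((m:ℝ)/2+1) := Real.Gamma_pos_of_pos (by positivity)
  unfold kap; positivity

lemma Fv_eq (n : ℕ) (t r : ℝ) (ht : 0 ≤ t) (hr : 0 ≤ r) : Fv n t (r^2) =
    ENNReal.ofReal (∑ m ∈ Finset.range (n+1), n.choose m * (r^m * kap m * t^(n-m))) := by
  rw [Fv_steiner n t ht, Finset.Nat.sum_antidiagonal_eq_sum_range_succ
    (fun i j => n.choose i • (Fv i 0 (r^2) * ENNReal.ofReal t ^ j)), ENNReal.ofReal_sum_of_nonneg]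
  · refine Finset.sum_congr rfl fun m _ => ?_
    have := kap_pos m
    rw [Fv_ball m r hr, ENNReal.ofReal_mul (p := (n.choose m : ℝ)) (by positivity),
      ENNReal.ofReal_mul (q := t^(n-m)) (by positivity), ENNReal.ofReal_pow ht]
    simp
  · intro m _
    have := kap_pos m
    positivity

/-- radius -/
noncomputable def rad (n : ℕ) : ℝ := ((kap n) ^ (1/(n:ℝ)))⁻¹

lemma rad_pos (n : ℕ) : 0 < rad n := by
  have := kap_pos n
  unfold rad; positivity

lemma mem_normBall (n : ℕ) (x : EuclideanSpace ℝ (Fin n)) : x ∈ normBall n ↔ ‖x‖ ≤ rad n := by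
  have h := vol_ball n 1 zero_le_one
  have : normBall n = Metric.closedBall 0 (rad n) := by
    unfold normBall
    rw [h, one_pow, one_mul, ENNReal.toReal_ofReal (kap_pos n).le]
    exact smul_unitClosedBall_of_nonneg (rad_pos n).le
  rw [this, mem_closedBall_zero_iff]

lemma mem_normCube (n : ℕ) (x : EuclideanSpace ℝ (Fin n)) :
    x ∈ normCube n ↔ ∀ i, |x i| ≤ 1/2 := by
  unfold normCube
  rw [Set.mem_smul_set_iff_inv_smul_mem₀ (by norm_num)]
  simp only [Set.mem_ofPred_eq, PiLp.smul_apply, smul_eq_mul, abs_mul]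
  refine forall_congr' fun i => ?_
  norm_num
  constructor <;> intro h <;> linarith

lemma rad_wt (n m : ℕ) (hn : n ≠ 0) : rad n ^ m * kap m = wt n m := by
  have h1 : 0 < Real.Gamma ((n:ℝ)/2+1) := Real.Gamma_pos_of_pos (by positivity)
  have h2 : 0 < Real.Gamma ((m:ℝ)/2+1) := Real.Gamma_pos_of_pos (by positivity)
  have hp : 0 < √Real.pi := by positivity
  have : rad n = Real.Gamma (n/2+1) ^ (1/(n:ℝ)) / √Real.pi := by
    unfold rad kap
    rw [Real.div_rpow (by positivity) h1.le, one_div, Real.pow_rpow_inv_natCast hp.le hn, inv_div]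
  unfold wt
  rw [this, kap]
  have : 0 < Real.Gamma ((n:ℝ)/2+1) ^ (1/(n:ℝ)) := by positivity
  generalize Real.Gamma ((n:ℝ)/2+1) ^ (1/(n:ℝ)) = x at *
  generalize Real.Gamma ((m:ℝ)/2+1) = y at *
  rw [div_pow]
  field_simp

/-- clamp -/
noncomputable def clp (t x : ℝ) : ℝ := max (-(t/2)) (min x (t/2))

lemma abs_clp (t x : ℝ) (ht : 0 ≤ t) : |clp t x| ≤ t/2 := by
  unfold clp
  rw [abs_le]
  exact ⟨le_max_left _ _, max_le (by linarith) (min_le_right _ _)⟩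

lemma abs_sub_clp (t x : ℝ) (ht : 0 ≤ t) : |x - clp t x| = exc t x := by
  unfold clp exc
  rcases le_total x (t/2) with h | h
  · rw [min_eq_left h]
    rcases le_total (-(t/2)) x with h' | h'
    · rw [max_eq_right h', sub_self, abs_zero, max_eq_right]
      have := abs_le.2 ⟨h', h⟩
      linarith
    · rw [max_eq_left h', abs_of_nonpos (by linarith), abs_of_nonpos (by linarith),
        max_eq_left (by linarith)]
      ring
  · rw [min_eq_right h, max_eq_right (by linarith), abs_of_nonneg (by linarith),
      abs_of_nonneg (by linarith), max_eq_left (by linarith)]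

lemma slice_iff (n : ℕ) (t : ℝ) (h0 : 0 ≤ t) (h1 : t ≤ 1) (x : EuclideanSpace ℝ (Fin n)) :
    (∃ k ∈ normBall n, ∃ l ∈ normCube n, (1-t) • k + t • l = x) ↔
      ∑ i, exc t (x i) ^ 2 ≤ ((1-t) * rad n) ^ 2 := by
  have hr := rad_pos n
  constructor
  · rintro ⟨k, hk, l, hl, rfl⟩
    rw [mem_normBall] at hk
    rw [mem_normCube] at hl
    have : ∑ i, exc t (((1-t) • k + t • l) i) ^ 2 ≤ ∑ i, ((1-t)^2 * ‖k i‖ ^ 2) := by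
      refine Finset.sum_le_sum fun i _ => ?_
      rw [← mul_pow]
      have : 0 ≤ exc t (((1-t) • k + t • l) i) := le_max_right _ _
      gcongr
      unfold exc
      apply max_le _ (mul_nonneg (by linarith) (norm_nonneg _))
      simp only [PiLp.add_apply, PiLp.smul_apply, smul_eq_mul, Real.norm_eq_abs]
      have a1 := abs_add_le ((1-t) * k i) (t * l i)
      rw [abs_mul, abs_mul, abs_of_nonneg h0, abs_of_nonneg (by linarith : 0 ≤ 1 - t)] at a1
      have := mul_le_mul_of_nonneg_left (hl i) h0
      linarith
    refine this.trans ?_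
    rw [← Finset.mul_sum, ← EuclideanSpace.norm_sq_eq, mul_pow]
    gcongr
  · intro h
    set y : EuclideanSpace ℝ (Fin n) := WithLp.toLp 2 (fun i => clp t (x i)) with hy
    have hyi : ∀ i, y i = clp t (x i) := fun i => rfl
    have hxy : ‖x - y‖ ≤ (1-t) * rad n := by
      have : ‖x - y‖^2 ≤ ((1-t) * rad n)^2 := by
        rw [EuclideanSpace.norm_sq_eq]
        simp only [PiLp.sub_apply, hyi, Real.norm_eq_abs, abs_sub_clp _ _ h0]
        exact h
      exact le_of_sq_le_sq this (mul_nonneg (by linarith) hr.le)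
    refine ⟨(1-t)⁻¹ • (x - y), ?_, t⁻¹ • y, ?_, ?_⟩
    · rw [mem_normBall, norm_smul]
      rcases h1.eq_or_lt with rfl | h1
      · simp [hr.le]
      · have : 0 < 1 - t := by linarith
        rw [norm_inv, Real.norm_eq_abs, abs_of_pos this, inv_mul_le_iff₀ this]
        exact hxy
    · rw [mem_normCube]
      intro i
      simp only [PiLp.smul_apply, smul_eq_mul, abs_mul, hyi]
      have := abs_clp t (x i) h0
      rcases h0.eq_or_lt with rfl | h0
      · simp
      · rw [abs_inv, abs_of_pos h0, inv_mul_le_iff₀ h0]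
        linarith
    · have e1 : (1-t) • (1-t)⁻¹ • (x - y) = x - y := by
        rcases h1.eq_or_lt with rfl | h1
        · have : x - y = 0 := by
            rw [← norm_le_zero_iff]; simpa using hxy
          simp [this]
        · rw [smul_inv_smul₀ (by linarith)]
      have e2 : t • t⁻¹ • y = y := by
        rcases h0.eq_or_lt with rfl | h0
        · have : y = 0 := by
            ext i
            have := abs_clp 0 (x i) le_rfl
            rw [hyi]
            simpa using this
          simp [this]
        · rw [smul_inv_smul₀ h0.ne']
      rw [e1, e2]; abel

lemma Mbody_eq_join (a b : ℝ) (n : ℕ) : Mbody a b n =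
    convexJoin ℝ (normBall n ×ˢ ({-a} : Set ℝ)) (normCube n ×ˢ ({b} : Set ℝ)) := by
  have hr := rad_pos n
  have cK : Convex ℝ (normBall n) := by
    unfold normBall; exact (convex_closedBall _ _).smul _
  have cL : Convex ℝ (normCube n) := by
    intro x hx y hy u v hu hv huv
    rw [mem_normCube] at *
    intro i
    simp only [PiLp.add_apply, PiLp.smul_apply, smul_eq_mul]
    have a1 := abs_add_le (u * x i) (v * y i)
    rw [abs_mul, abs_mul, abs_of_nonneg hu, abs_of_nonneg hv] at a1
    have := mul_le_mul_of_nonneg_left (hx i) hu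
    have := mul_le_mul_of_nonneg_left (hy i) hv
    nlinarith
  have K0 : (0 : EuclideanSpace ℝ (Fin n)) ∈ normBall n := by rw [mem_normBall]; simpa using hr.le
  have L0 : (0 : EuclideanSpace ℝ (Fin n)) ∈ normCube n := by rw [mem_normCube]; simp
  have neK : (normBall n ×ˢ ({-a} : Set ℝ)).Nonempty := ⟨(0, -a), K0, Set.mem_singleton _⟩
  have neL : (normCube n ×ˢ ({b} : Set ℝ)).Nonempty := ⟨(0, b), L0, Set.mem_singleton _⟩
  have c1 : Convex ℝ (normBall n ×ˢ ({-a} : Set ℝ)) := cK.prod (convex_singleton _)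
  have c2 : Convex ℝ (normCube n ×ˢ ({b} : Set ℝ)) := cL.prod (convex_singleton _)
  unfold Mbody
  rw [convexHull_union neK neL, c1.convexHull_eq, c2.convexHull_eq]

lemma mem_Mbody (a b : ℝ) (ha : 0 < a) (hb : 0 < b) (n : ℕ) (p : EuclideanSpace ℝ (Fin n) × ℝ) :
    p ∈ Mbody a b n ↔ p.2 ∈ Set.Icc (-a) b ∧
      ∑ i, exc ((p.2 + a)/(a+b)) (p.1 i) ^ 2 ≤ ((1-(p.2 + a)/(a+b)) * rad n) ^ 2 := by
  have hr := rad_pos n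
  have hab : 0 < a + b := by linarith
  rw [Mbody_eq_join, mem_convexJoin]
  constructor
  · rintro ⟨⟨k, k2⟩, hk, ⟨l, l2⟩, hl, u, v, hu, hv, huv, hp⟩
    simp only [Set.mem_prod, Set.mem_singleton_iff] at hk hl
    have hu' : u = 1 - v := by linarith
    have p1 : (1-v) • k + v • l = p.1 := by rw [← hp, hu']; rfl
    have p2 : p.2 = (1-v) * (-a) + v * b := by rw [← hp, hu', hk.2, hl.2]; rfl
    have e : (p.2 + a)/(a+b) = v := by
      rw [p2, div_eq_iff hab.ne']; ring
    rw [e]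
    have v1 : v ≤ 1 := by linarith
    refine ⟨⟨?_, ?_⟩, (slice_iff n v hv v1 _).1 ⟨k, hk.1, l, hl.1, p1⟩⟩
    · rw [p2]; nlinarith
    · rw [p2]; nlinarith
  · rintro ⟨⟨hl, hu⟩, h⟩
    have t0 : 0 ≤ (p.2 + a)/(a+b) := div_nonneg (by linarith) hab.le
    have t1 : (p.2 + a)/(a+b) ≤ 1 := (div_le_one hab).2 (by linarith)
    obtain ⟨k, hk, l, hl, hx⟩ := (slice_iff n _ t0 t1 _).2 h
    have t2 : 0 ≤ 1 - (p.2 + a)/(a+b) := by linarith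
    have hh : (1 - (p.2 + a)/(a+b)) * (-a) + (p.2 + a)/(a+b) * b = p.2 := by field_simp; ring
    refine ⟨(k, -a), ⟨hk, Set.mem_singleton _⟩, (l, b), ⟨hl, Set.mem_singleton _⟩,
      1 - (p.2 + a)/(a+b), (p.2 + a)/(a+b), t2, t0, sub_add_cancel _ _, ?_⟩
    exact Prod.ext hx hh

lemma Mbody_compact (a b : ℝ) (ha : 0 < a) (hb : 0 < b) (n : ℕ) : IsCompact (Mbody a b n) := by
  apply Metric.isCompact_of_isClosed_isBounded
  · have : Mbody a b n = {p | p.2 ∈ Set.Icc (-a) b ∧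
      ∑ i, exc ((p.2 + a)/(a+b)) (p.1 i) ^ 2 ≤ ((1-(p.2 + a)/(a+b)) * rad n) ^ 2} := by
      ext p; exact mem_Mbody a b ha hb n p
    rw [this]
    have h1 : IsClosed {p : EuclideanSpace ℝ (Fin n) × ℝ | p.2 ∈ Set.Icc (-a) b} :=
      isClosed_Icc.preimage continuous_snd
    have h2 : IsClosed {p : EuclideanSpace ℝ (Fin n) × ℝ |
      ∑ i, exc ((p.2 + a)/(a+b)) (p.1 i) ^ 2 ≤ ((1-(p.2 + a)/(a+b)) * rad n) ^ 2} := by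
      unfold exc
      apply isClosed_le <;> fun_prop
    exact h1.inter h2
  · unfold Mbody
    rw [isBounded_convexHull]
    apply Bornology.IsBounded.union
    · apply Bornology.IsBounded.prod _ Bornology.isBounded_singleton
      unfold normBall
      exact Metric.isBounded_closedBall.smul₀ _
    · apply Bornology.IsBounded.prod _ Bornology.isBounded_singleton
      rw [isBounded_iff_forall_norm_le]
      refine ⟨√(∑ i : Fin n, (1/2)^2), fun x hx => ?_⟩
      rw [mem_normCube] at hx
      rw [EuclideanSpace.norm_eq]
      gcongr with i
      exact hx i

lemma centroid_fst (a b : ℝ) (n : ℕ) : (centroid (Mbody a b n)).1 = 0 := by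
  let σ : (EuclideanSpace ℝ (Fin n) × ℝ) ≃L[ℝ] (EuclideanSpace ℝ (Fin n) × ℝ) :=
    (ContinuousLinearEquiv.neg ℝ).prodCongr (ContinuousLinearEquiv.refl ℝ ℝ)
  have hσ : ∀ p, σ p = (-p.1, p.2) := fun p => rfl
  have hmp : MeasurePreserving σ volume volume :=
    (Measure.measurePreserving_neg (volume : Measure (EuclideanSpace ℝ (Fin n)))).prod
      (MeasurePreserving.id (volume : Measure ℝ))
  have hinv : σ ⁻¹' (Mbody a b n) = Mbody a b n := by
    have sub : Mbody a b n ⊆ σ ⁻¹' (Mbody a b n) := by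
      unfold Mbody
      apply convexHull_min
      · rintro ⟨x, h⟩ hp
        apply subset_convexHull
        rw [hσ]
        rcases hp with ⟨hx, hh⟩ | ⟨hx, hh⟩
        · left; refine ⟨?_, hh⟩
          simp only [mem_normBall, norm_neg] at *; exact hx
        · right; refine ⟨?_, hh⟩
          simp only [mem_normCube, PiLp.neg_apply, abs_neg] at *; exact hx
      · exact (convex_convexHull ℝ _).linear_preimage σ.toLinearEquiv.toLinearMap
    apply le_antisymm _ sub
    intro p hp
    have := sub hp
    simp only [Set.mem_preimage, hσ, neg_neg] at this
    exact this
  have h : ∫ p in Mbody a b n, p = σ (∫ p in Mbody a b n, p) := by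
    rw [← ContinuousLinearEquiv.integral_comp_comm]
    conv_rhs => rw [← hinv]
    rw [hmp.setIntegral_preimage_emb σ.toHomeomorph.measurableEmbedding (fun p => p)]
  have h1 := congrArg Prod.fst h
  rw [hσ] at h1
  unfold centroid
  simp only [Prod.smul_fst]
  have h2 : (2:ℝ) • (∫ p in Mbody a b n, p).1 = 0 := by
    rw [two_smul]
    exact eq_neg_iff_add_eq_zero.1 h1
  rw [(smul_eq_zero_iff_right (by norm_num : (2:ℝ) ≠ 0)).1 h2, smul_zero]

/-- the slice polynomial -/
noncomputable def Pn (n : ℕ) (s : ℝ) : ℝ :=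
  ∑ m ∈ Finset.range (n+1), n.choose m * (((1-s) * rad n)^m * kap m * s^(n-m))

lemma Pn_nonneg (n : ℕ) (s : ℝ) (h0 : 0 ≤ s) (h1 : s ≤ 1) : 0 ≤ Pn n s := by
  refine Finset.sum_nonneg fun m _ => ?_
  have := kap_pos m
  have := rad_pos n
  have : 0 ≤ 1 - s := by linarith
  positivity

lemma int_Mbody (a b : ℝ) (ha : 0 < a) (hb : 0 < b) (n : ℕ) (φ : ℝ → ℝ) (hφ : Continuous φ) :
    ∫ p in Mbody a b n, φ p.2 = (a+b) * ∫ s in (0:ℝ)..1, φ (-a + (a+b)*s) * Pn n s := by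
  have hab : 0 < a + b := by linarith
  have hc := Mbody_compact a b ha hb n
  have hm := hc.measurableSet
  have hIntg : IntegrableOn (fun p : EuclideanSpace ℝ (Fin n) × ℝ => φ p.2) (Mbody a b n) volume :=
    (hφ.comp continuous_snd).continuousOn.integrableOn_compact hc
  rw [← integral_indicator hm]
  rw [← integrable_indicator_iff hm] at hIntg
  rw [Measure.volume_eq_prod] at hIntg ⊢
  rw [integral_prod_symm _ hIntg]
  have hin : ∀ h : ℝ, ∫ x, (Mbody a b n).indicator (fun p => φ p.2) (x, h) =
      (Set.Icc (-a) b).indicator (fun h => φ h * Pn n ((h+a)/(a+b))) h := by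
    intro h
    by_cases hh : h ∈ Set.Icc (-a) b
    · rw [Set.indicator_of_mem hh]
      have t0 : 0 ≤ (h + a)/(a+b) := div_nonneg (by linarith [hh.1]) hab.le
      have t1 : (h + a)/(a+b) ≤ 1 := (div_le_one hab).2 (by linarith [hh.2])
      set S := {x : EuclideanSpace ℝ (Fin n) | ∑ i, exc ((h + a)/(a+b)) (x i) ^ 2 ≤
        ((1-(h + a)/(a+b)) * rad n) ^ 2} with hS
      have hSm : MeasurableSet S := by
        apply IsClosed.measurableSet
        have hec := exc_cont ((h+a)/(a+b))
        apply isClosed_le <;> fun_prop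
      have e : (fun x => (Mbody a b n).indicator (fun p => φ p.2) (x, h)) =
          S.indicator (fun _ => φ h) := by
        ext x
        by_cases hx : x ∈ S
        · rw [Set.indicator_of_mem hx, Set.indicator_of_mem]
          exact (mem_Mbody a b ha hb n (x,h)).2 ⟨hh, hx⟩
        · rw [Set.indicator_of_notMem hx, Set.indicator_of_notMem]
          exact fun h' => hx ((mem_Mbody a b ha hb n (x,h)).1 h').2
      rw [e, integral_indicator hSm, setIntegral_const, Measure.real, hS, vol_eq_Fv,
        Fv_eq n _ _ t0 (mul_nonneg (by linarith) (rad_pos n).le)]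
      change (ENNReal.ofReal (Pn n ((h+a)/(a+b)))).toReal • φ h = _
      rw [ENNReal.toReal_ofReal (Pn_nonneg n _ t0 t1), smul_eq_mul, mul_comm]
    · rw [Set.indicator_of_notMem hh]
      have e : (fun x => (Mbody a b n).indicator (fun p => φ p.2) (x, h)) = fun _ => 0 := by
        ext x
        rw [Set.indicator_of_notMem]
        exact fun h' => hh ((mem_Mbody a b ha hb n (x,h)).1 h').1
      rw [e, integral_zero]
  simp only [hin]
  rw [integral_indicator measurableSet_Icc, integral_Icc_eq_integral_Ioc,
    ← intervalIntegral.integral_of_le (by linarith)]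
  have := intervalIntegral.smul_integral_comp_add_mul (a := 0) (b := 1)
    (fun h => φ h * Pn n ((h+a)/(a+b))) (a+b) (-a)
  rw [show -a + (a+b) * 0 = -a by ring, show -a + (a+b)*1 = b by ring] at this
  rw [← this, smul_eq_mul]
  congr 2
  ext s
  rw [show (-a + (a+b)*s + a)/(a+b) = s by field_simp; ring]

lemma Pn_eq (n : ℕ) (hn : n ≠ 0) (s : ℝ) : Pn n s =
    ∑ m ∈ Finset.range (n+1), (n.choose m * wt n m) * ((1-s)^m * s^(n-m)) := by
  refine Finset.sum_congr rfl fun m _ => ?_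
  rw [← rad_wt n m hn, mul_pow]; ring

lemma int_Pn (n : ℕ) (hn : n ≠ 0) : ∫ s in (0:ℝ)..1, Pn n s =
    (∑ m ∈ Finset.range (n+1), wt n m) / (n+1) := by
  simp only [Pn_eq n hn]
  rw [intervalIntegral.integral_finsetSum
    (fun m _ => Continuous.intervalIntegrable (by fun_prop) _ _), Finset.sum_div]
  refine Finset.sum_congr rfl fun m hm => ?_
  obtain ⟨k, rfl⟩ := Nat.exists_eq_add_of_le (Finset.mem_range_succ_iff.1 hm)
  rw [intervalIntegral.integral_const_mul, Nat.add_sub_cancel_left, beta_nat,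
    Nat.cast_choose ℝ (by omega), Nat.add_sub_cancel_left, Nat.factorial_succ]
  push_cast
  field_simp

lemma int_Pn' (n : ℕ) (hn : n ≠ 0) : ∫ s in (0:ℝ)..1, (1-s) * Pn n s =
    (∑ m ∈ Finset.range (n+1), ((m:ℝ)+1) * wt n m) / ((n+1)*(n+2)) := by
  simp only [Pn_eq n hn, Finset.mul_sum]
  rw [intervalIntegral.integral_finsetSum
    (fun m _ => Continuous.intervalIntegrable (by fun_prop) _ _), Finset.sum_div]
  refine Finset.sum_congr rfl fun m hm => ?_
  obtain ⟨k, rfl⟩ := Nat.exists_eq_add_of_le (Finset.mem_range_succ_iff.1 hm)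
  have e : ∀ s : ℝ, (1-s) * (((m+k).choose m * wt (m+k) m) * ((1-s)^m * s^(m+k-m))) =
    ((m+k).choose m * wt (m+k) m) * ((1-s)^(m+1) * s^(m+k-m)) := by intro s; ring
  simp only [e]
  rw [intervalIntegral.integral_const_mul, Nat.add_sub_cancel_left, beta_nat,
    Nat.cast_choose ℝ (by omega), Nat.add_sub_cancel_left,
    show m + 1 + k + 1 = m + k + 1 + 1 by ring, Nat.factorial_succ (m+k+1), Nat.factorial_succ (m+k),
    Nat.factorial_succ m]
  push_cast
  have : (m:ℝ) + k + 1 + 1 = m + k + 2 := by ring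
  rw [this]
  field_simp

lemma centroid_snd (a b : ℝ) (ha : 0 < a) (hb : 0 < b) (n : ℕ) (hn : n ≠ 0) :
    (centroid (Mbody a b n)).2 = b - (a+b) * ((∑ m ∈ Finset.range (n+1), ((m:ℝ)+1) * wt n m) /
    (((n:ℝ)+2) * ∑ m ∈ Finset.range (n+1), wt n m)) := by
  have hab : 0 < a + b := by linarith
  have hc := Mbody_compact a b ha hb n
  have hPc : Continuous (Pn n) := by unfold Pn; fun_prop
  have hIntg : IntegrableOn (fun p : EuclideanSpace ℝ (Fin n) × ℝ => p) (Mbody a b n) volume :=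
    continuousOn_id.integrableOn_compact hc
  have h2 : (∫ p in Mbody a b n, p).2 = ∫ p in Mbody a b n, p.2 :=
    ((ContinuousLinearMap.snd ℝ (EuclideanSpace ℝ (Fin n)) ℝ).integral_comp_comm hIntg).symm
  have hv : (volume (Mbody a b n)).toReal = ∫ p in Mbody a b n, (1:ℝ) := by
    simp [Measure.real]
  unfold centroid
  rw [Prod.smul_snd, h2, hv, int_Mbody a b ha hb n (fun _ => 1) continuous_const,
    int_Mbody a b ha hb n (fun h => h) continuous_id]
  simp only [one_mul]
  have e : ∀ s : ℝ, (-a + (a+b)*s) * Pn n s = b * Pn n s - (a+b) * ((1-s) * Pn n s) := by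
    intro s; ring
  simp only [e]
  rw [intervalIntegral.integral_sub (Continuous.intervalIntegrable (by fun_prop) _ _)
    (Continuous.intervalIntegrable (by fun_prop) _ _), intervalIntegral.integral_const_mul,
    intervalIntegral.integral_const_mul, int_Pn n hn, int_Pn' n hn]
  have hS : 0 < ∑ m ∈ Finset.range (n+1), wt n m :=
    Finset.sum_pos (fun m _ => wt_pos n m) (by simp)
  generalize ∑ m ∈ Finset.range (n+1), wt n m = S at *
  generalize ∑ m ∈ Finset.range (n+1), ((m:ℝ)+1) * wt n m = T at *
  rw [smul_eq_mul]
  field_simp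

/-- With `K = B₂ⁿ/vol(B₂ⁿ)^{1/n}`, `L = ½B_∞ⁿ` and `M_n = co[(K,-a),(L,b)]`, the last
coordinate of the centroid of `M_n` tends to `(1/e)(-a) + (1 - 1/e)b` and all other
coordinates vanish. -/
theorem centroid_of_Mbody_limit (a b : ℝ) (ha : 0 < a) (hb : 0 < b) :
    (∀ n : ℕ, (centroid (Mbody a b n)).1 = 0) ∧
      Tendsto (fun n : ℕ => (centroid (Mbody a b n)).2) atTop
        (nhds ((1 / Real.exp 1) * (-a) + (1 - 1 / Real.exp 1) * b)) := by
  refine ⟨fun n => centroid_fst a b n, ?_⟩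
  have h := (ratio_tendsto.const_mul (a+b)).const_sub b
  rw [show (1 / Real.exp 1) * (-a) + (1 - 1 / Real.exp 1) * b = b - (a+b) * (1 / Real.exp 1) by ring]
  refine h.congr' ?_
  filter_upwards [eventually_ne_atTop 0] with n hn
  rw [centroid_snd a b ha hb n hn]
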